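/- For every permutation π of {1,2,3,4} there exist matrices U, V in SU(2) such that for every real 4-vector λ = (λ₁,λ₂,λ₃,λ₄), (U ⊗ V) · M diag(λ) M† · (U ⊗ V)† = M diag(λ_{π⁻¹(1)}, λ_{π⁻¹(2)}, λ_{π⁻¹(3)}, λ_{π⁻¹(4)}) M†. In other words, every permutation of the magic-basis eigenvalues of a magic-basis-diagonal Hamiltonian can be realized by conjugation with a local unitary U ⊗ V. -/

import Mathlib

open Matrix Complex Real NormedSpace

noncomputable section

/-- Pauli matrix `σ₁`. -/
def σ1 : Matrix (Fin 2) (Fin 2) ℂ := !![0, 1; 1, 0]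
/-- Pauli matrix `σ₂`. -/
def σ2 : Matrix (Fin 2) (Fin 2) ℂ := !![0, -I; I, 0]
/-- Pauli matrix `σ₃`. -/
def σ3 : Matrix (Fin 2) (Fin 2) ℂ := !![1, 0; 0, -1]

/-- Kronecker product of two `2×2` matrices as a `4×4` matrix, with the index ordering
`|00⟩,|01⟩,|10⟩,|11⟩` (i.e. index `2*i+j` corresponds to `|i⟩⊗|j⟩`). -/
def kron (A B : Matrix (Fin 2) (Fin 2) ℂ) : Matrix (Fin 4) (Fin 4) ℂ :=
  Matrix.of fun i j =>
    A ⟨i.val / 2, by have := i.isLt; omega⟩ ⟨j.val / 2, by have := j.isLt; omega⟩ *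
      B ⟨i.val % 2, by have := i.isLt; omega⟩ ⟨j.val % 2, by have := j.isLt; omega⟩

/-- The Hamiltonian `H_α = α₁ σ₁⊗σ₁ + α₂ σ₂⊗σ₂ + α₃ σ₃⊗σ₃`. -/
def Hmat (a : Fin 3 → ℝ) : Matrix (Fin 4) (Fin 4) ℂ :=
  (a 0 : ℂ) • kron σ1 σ1 + (a 1 : ℂ) • kron σ2 σ2 + (a 2 : ℂ) • kron σ3 σ3

/-- The magic basis matrix: column `j` is the `j`-th magic basis vector, written in the
computational basis `|00⟩,|01⟩,|10⟩,|11⟩`. -/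
def Mmag : Matrix (Fin 4) (Fin 4) ℂ :=
  !![0,                      1 / (Real.sqrt 2 : ℂ), -I / (Real.sqrt 2 : ℂ), 0;
     -I / (Real.sqrt 2 : ℂ), 0,                     0,                      1 / (Real.sqrt 2 : ℂ);
     -I / (Real.sqrt 2 : ℂ), 0,                     0,                      -(1 / (Real.sqrt 2 : ℂ));
     0,                      1 / (Real.sqrt 2 : ℂ), I / (Real.sqrt 2 : ℂ),  0]

/-- `λ(α) = (α₁+α₂−α₃, α₁−α₂+α₃, −α₁+α₂+α₃, −α₁−α₂−α₃)`, the vector of eigenvalues of `H_α`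
in the magic basis. -/
def lamv (a : Fin 3 → ℝ) : Fin 4 → ℝ :=
  ![a 0 + a 1 - a 2, a 0 - a 1 + a 2, -a 0 + a 1 + a 2, -a 0 - a 1 - a 2]

lemma kron_mul_kron (A B C D : Matrix (Fin 2) (Fin 2) ℂ) :
    kron A B * kron C D = kron (A * C) (B * D) := by
  ext i j
  simp only [kron, Matrix.mul_apply, Matrix.of_apply, Fin.sum_univ_four, Fin.sum_univ_two]
  norm_num
  ring

lemma inv_sqrt_two_mul_self : ((Real.sqrt 2 : ℂ))⁻¹ * ((Real.sqrt 2 : ℂ))⁻¹ = 1 / 2 := by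
  rw [← mul_inv, ← Complex.ofReal_mul, Real.mul_self_sqrt (by norm_num)]
  norm_num

/-- The Hamiltonian with magic-basis eigenvalues `l`, in the computational basis. -/
lemma Mmag_mul_diagonal_mul_conjTranspose (l : Fin 4 → ℂ) :
    Mmag * Matrix.diagonal l * Mmagᴴ =
      (1 / 2 : ℂ) • !![l 1 + l 2, 0, 0, l 1 - l 2;
        0, l 0 + l 3, l 0 - l 3, 0;
        0, l 0 - l 3, l 0 + l 3, 0;
        l 1 - l 2, 0, 0, l 1 + l 2] := by
  have h := inv_sqrt_two_mul_self
  ext i j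
  fin_cases i <;> fin_cases j <;>
    simp [Mmag, Matrix.mul_apply, Fin.sum_univ_four, Matrix.vecMul_diagonal, div_eq_mul_inv] <;>
    grind [Complex.I_mul_I]

lemma inv_sqrt_two_smul_mem_specialUnitaryGroup {A : Matrix (Fin 2) (Fin 2) ℂ}
    (hA : A * Aᴴ = (2 : ℂ) • 1) (hdet : A.det = 2) :
    ((Real.sqrt 2 : ℂ))⁻¹ • A ∈ Matrix.specialUnitaryGroup (Fin 2) ℂ := by
  rw [Matrix.mem_specialUnitaryGroup_iff, Matrix.mem_unitaryGroup_iff, Matrix.star_eq_conjTranspose]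
  constructor
  · rw [Matrix.conjTranspose_smul, smul_mul_smul_comm, hA, smul_smul]
    simp only [star_inv₀, RCLike.star_def, Complex.conj_ofReal, inv_sqrt_two_mul_self]
    norm_num
  · rw [Matrix.det_smul, hdet, Fintype.card_fin, pow_two, inv_sqrt_two_mul_self]
    norm_num

/-- The permutation `p` of the magic-basis eigenvalues is realized by a local special unitary. -/
def IsLocallyRealizable (p : Equiv.Perm (Fin 4)) : Prop :=
  ∃ U V : Matrix (Fin 2) (Fin 2) ℂ,
    U ∈ Matrix.specialUnitaryGroup (Fin 2) ℂ ∧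
    V ∈ Matrix.specialUnitaryGroup (Fin 2) ℂ ∧
    ∀ lam : Fin 4 → ℝ,
      kron U V * (Mmag * Matrix.diagonal (fun j => (lam j : ℂ)) * Mmagᴴ) * (kron U V)ᴴ =
        Mmag * Matrix.diagonal (fun j => (lam (p⁻¹ j) : ℂ)) * Mmagᴴ

lemma IsLocallyRealizable.one : IsLocallyRealizable 1 := by
  refine ⟨1, 1, one_mem _, one_mem _, fun lam => ?_⟩
  have h : kron 1 1 = 1 := by
    ext i j
    fin_cases i <;> fin_cases j <;> simp [kron, Matrix.one_apply]
  simp [h]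

lemma IsLocallyRealizable.mul {p q : Equiv.Perm (Fin 4)} (hp : IsLocallyRealizable p)
    (hq : IsLocallyRealizable q) : IsLocallyRealizable (p * q) := by
  obtain ⟨U, V, hU, hV, h⟩ := hp
  obtain ⟨U', V', hU', hV', h'⟩ := hq
  refine ⟨U * U', V * V', mul_mem hU hU', mul_mem hV hV', fun lam => ?_⟩
  have key := h (fun j => lam (q⁻¹ j))
  rw [← h' lam] at key
  simp only [_root_.mul_inv_rev, Equiv.Perm.mul_apply]
  rw [← key, ← kron_mul_kron, Matrix.conjTranspose_mul]
  simp only [Matrix.mul_assoc]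

/-- A pair of matrices which are special unitary up to the factor `√2` realizes `p` as soon as
their Kronecker product intertwines the two Hamiltonians. -/
lemma IsLocallyRealizable.of_intertwines {p : Equiv.Perm (Fin 4)}
    {A B : Matrix (Fin 2) (Fin 2) ℂ}
    (hA : A * Aᴴ = (2 : ℂ) • 1) (hA' : A.det = 2) (hB : B * Bᴴ = (2 : ℂ) • 1) (hB' : B.det = 2)
    (h : ∀ lam : Fin 4 → ℝ,
      kron A B * (Mmag * Matrix.diagonal (fun j => (lam j : ℂ)) * Mmagᴴ) =
        Mmag * Matrix.diagonal (fun j => (lam (p⁻¹ j) : ℂ)) * Mmagᴴ * kron A B) :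
    IsLocallyRealizable p := by
  refine ⟨_, _, inv_sqrt_two_smul_mem_specialUnitaryGroup hA hA',
    inv_sqrt_two_smul_mem_specialUnitaryGroup hB hB', fun lam => ?_⟩
  have hk : kron (((Real.sqrt 2 : ℂ))⁻¹ • A) (((Real.sqrt 2 : ℂ))⁻¹ • B) =
      (1 / 2 : ℂ) • kron A B := by
    ext i j
    simp only [kron, Matrix.of_apply, Matrix.smul_apply, smul_eq_mul, ← inv_sqrt_two_mul_self]
    ring
  have hstar : (kron A B)ᴴ = kron Aᴴ Bᴴ := by
    ext i j
    simp [kron]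
  have hone : kron ((2 : ℂ) • 1) ((2 : ℂ) • 1) = (4 : ℂ) • 1 := by
    ext i j
    fin_cases i <;> fin_cases j <;> simp [kron, Matrix.one_apply] <;> norm_num
  rw [hk, Matrix.conjTranspose_smul, Matrix.smul_mul, h, Matrix.smul_mul, Matrix.mul_smul,
    Matrix.mul_assoc _ (kron A B), hstar, kron_mul_kron, hA, hB, hone, Matrix.mul_smul, mul_one,
    smul_smul, smul_smul]
  norm_num

lemma IsLocallyRealizable.swap_zero_one : IsLocallyRealizable (Equiv.swap 0 1) := by
  refine .of_intertwines (A := !![1, I; I, 1]) (B := !![1, I; I, 1]) ?_ ?_ ?_ ?_ fun lam => ?_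
  case refine_5 =>
    have h0 : (Equiv.swap 0 1 : Equiv.Perm (Fin 4)) 2 = 2 := by decide
    have h1 : (Equiv.swap 0 1 : Equiv.Perm (Fin 4)) 3 = 3 := by decide
    simp only [Mmag_mul_diagonal_mul_conjTranspose, Equiv.swap_inv, Equiv.swap_apply_left,
      Equiv.swap_apply_right, h0, h1]
    ext i j
    fin_cases i <;> fin_cases j <;>
      simp [kron, Matrix.mul_apply, Fin.sum_univ_four] <;> grind [Complex.I_mul_I]
  all_goals
    first
    | (norm_num [Matrix.det_fin_two]; done)
    | (ext i j; fin_cases i <;> fin_cases j <;> simp [Matrix.mul_apply] <;> norm_num)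

lemma IsLocallyRealizable.swap_one_two : IsLocallyRealizable (Equiv.swap 1 2) := by
  refine .of_intertwines (A := !![1 + I, 0; 0, 1 - I]) (B := !![1 + I, 0; 0, 1 - I])
    ?_ ?_ ?_ ?_ fun lam => ?_
  case refine_5 =>
    have h0 : (Equiv.swap 1 2 : Equiv.Perm (Fin 4)) 0 = 0 := by decide
    have h1 : (Equiv.swap 1 2 : Equiv.Perm (Fin 4)) 3 = 3 := by decide
    simp only [Mmag_mul_diagonal_mul_conjTranspose, Equiv.swap_inv, Equiv.swap_apply_left,
      Equiv.swap_apply_right, h0, h1]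
    ext i j
    fin_cases i <;> fin_cases j <;>
      simp [kron, Matrix.mul_apply, Fin.sum_univ_four] <;> grind [Complex.I_mul_I]
  all_goals
    first
    | (simp [Matrix.det_fin_two]; grind [Complex.I_mul_I])
    | (ext i j; fin_cases i <;> fin_cases j <;> simp [Matrix.mul_apply] <;> grind [Complex.I_mul_I])

lemma IsLocallyRealizable.swap_two_three : IsLocallyRealizable (Equiv.swap 2 3) := by
  refine .of_intertwines (A := !![1, I; I, 1]) (B := !![1, -I; -I, 1]) ?_ ?_ ?_ ?_ fun lam => ?_
  case refine_5 =>
    have h0 : (Equiv.swap 2 3 : Equiv.Perm (Fin 4)) 0 = 0 := by decide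
    have h1 : (Equiv.swap 2 3 : Equiv.Perm (Fin 4)) 1 = 1 := by decide
    simp only [Mmag_mul_diagonal_mul_conjTranspose, Equiv.swap_inv, Equiv.swap_apply_left,
      Equiv.swap_apply_right, h0, h1]
    ext i j
    fin_cases i <;> fin_cases j <;>
      simp [kron, Matrix.mul_apply, Fin.sum_univ_four] <;> grind [Complex.I_mul_I]
  all_goals
    first
    | (norm_num [Matrix.det_fin_two]; done)
    | (ext i j; fin_cases i <;> fin_cases j <;> simp [Matrix.mul_apply] <;> norm_num)

theorem stmt6 (p : Equiv.Perm (Fin 4)) :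
    ∃ U V : Matrix (Fin 2) (Fin 2) ℂ,
      U ∈ Matrix.specialUnitaryGroup (Fin 2) ℂ ∧
      V ∈ Matrix.specialUnitaryGroup (Fin 2) ℂ ∧
      ∀ lam : Fin 4 → ℝ,
        kron U V * (Mmag * Matrix.diagonal (fun j => (lam j : ℂ)) * Mmagᴴ) * (kron U V)ᴴ =
          Mmag * Matrix.diagonal (fun j => (lam (p⁻¹ j) : ℂ)) * Mmagᴴ := by
  change IsLocallyRealizable p
  have hp : p ∈ Submonoid.closure
      (Set.range fun i : Fin 3 => Equiv.swap i.castSucc i.succ) := by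
    rw [Equiv.Perm.mclosure_swap_castSucc_succ]
    trivial
  induction hp using Submonoid.closure_induction with
  | mem q hq =>
    obtain ⟨i, rfl⟩ := hq
    fin_cases i
    · exact .swap_zero_one
    · exact .swap_one_two
    · exact .swap_two_three
  | one => exact .one
  | mul _ _ _ _ hq hr => exact hq.mul hr
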